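/- For every α ∈ k with α ∉ {0, 1, ω, ω̄}, the stabilizer subgroup {g ∈ PGL(3,k) : g(Z_B(α)) = Z_B(α)} of the 21-point set Z_B(α) under the natural action of PGL(3,k) on P²(k) is equal to the subgroup of PGL(3,k) generated by the images of the three matrices with rows (0, ω, 0), (ω̄, 1, 0), (1, 1, 1); with rows (0, 0, ω̄), (1, 1, 1), (ω, 0, 1); and with rows (1, 0, 0), (ω̄, 1, 0), (ω, 0, 1); in particular this stabilizer has order 18. -/

import Mathlib

/-- The natural action of an invertible matrix `g ∈ GL(3,k)` on the projective plane
`P²(k)`. -/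
noncomputable def actGL (k : Type*) [Field k] (g : Matrix.GeneralLinearGroup (Fin 3) k) :
    Projectivization k (Fin 3 → k) → Projectivization k (Fin 3 → k) := fun P =>
  Projectivization.mk k ((g : Matrix (Fin 3) (Fin 3) k).mulVec P.rep) (by
    intro h
    apply P.rep_nonzero
    have h2 : ((g⁻¹ : Matrix.GeneralLinearGroup (Fin 3) k) : Matrix (Fin 3) (Fin 3) k).mulVec
        (((g : Matrix (Fin 3) (Fin 3) k)).mulVec P.rep) = P.rep := by
      rw [Matrix.mulVec_mulVec, g.inv_mul, Matrix.one_mulVec]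
    rw [h, Matrix.mulVec_zero] at h2
    exact h2.symm)

/-- `PGL(3,k)`: the quotient of `GL(3,k)` by its center (the nonzero scalar matrices). -/
abbrev PGL3 (k : Type*) [Field k] : Type _ :=
  Matrix.GeneralLinearGroup (Fin 3) k ⧸ Subgroup.center (Matrix.GeneralLinearGroup (Fin 3) k)

/-- The 21 coordinate vectors of the points of `Z_B(λ)` (ω̄ = ω + 1). -/
def ZBvec (k : Type*) [CommRing k] (ω l : k) : Set (Fin 3 → k) :=
  {![l + 1, (ω + 1) * l + ω, (ω + 1) * l + ω],
   ![1, ω * l + ω, ω],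
   ![l + ω + 1, 1, l + 1],
   ![1, ω, ω],
   ![l, (ω + 1) * l, (ω + 1) * l + ω + 1],
   ![l + ω + 1, (ω + 1) * l + ω + 1, (ω + 1) * l],
   ![1, ω + 1, ω + 1],
   ![l + 1, 1, l],
   ![1, ω + 1, ω],
   ![1, ω * l + 1, 0],
   ![1, ω + 1, 0],
   ![1, 1, 0],
   ![l, 0, l + ω + 1],
   ![1, 0, ω],
   ![1, 0, 1],
   ![1, 0, 0],
   ![0, l, 1],
   ![0, 1, ω],
   ![0, 1, 1],
   ![0, 1, 0],
   ![0, 0, 1]}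

/-- The 21-point set `Z_B(λ)` in the projective plane `P²(k)`. -/
def ZBpts (k : Type*) [Field k] (ω l : k) : Set (Projectivization k (Fin 3 → k)) :=
  {P | ∃ v ∈ ZBvec k ω l, ∃ hv : v ≠ 0, P = Projectivization.mk k v hv}

/-- The stabilizer of a subset `Z ⊆ P²(k)` in `PGL(3,k)`: the elements of `PGL(3,k)` all of
whose lifts to `GL(3,k)` map `Z` onto itself. -/
def PGLstab (k : Type*) [Field k] (Z : Set (Projectivization k (Fin 3 → k))) : Set (PGL3 k) :=
  {x | ∀ g : Matrix.GeneralLinearGroup (Fin 3) k, QuotientGroup.mk g = x → actGL k g '' Z = Z}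

/-- The field with four elements, `(a, b)` standing for `a + b * ω`. -/
abbrev GF4 : Type := Bool × Bool

namespace GF4

/-- Addition in the field with four elements. -/
def add (x y : GF4) : GF4 := (xor x.1 y.1, xor x.2 y.2)

/-- Multiplication in the field with four elements. -/
def mul (x y : GF4) : GF4 :=
  (xor (x.1 && y.1) (x.2 && y.2), xor (xor (x.1 && y.2) (x.2 && y.1)) (x.2 && y.2))

/-- Evaluation of `a + b * ω`. -/
def eval {k : Type*} [CommRing k] (ω : k) (x : GF4) : k :=
  (if x.1 then 1 else 0) + (if x.2 then ω else 0)

variable {k : Type*} [CommRing k] [CharP k 2] {ω : k}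

theorem eval_add (x y : GF4) : eval ω (add x y) = eval ω x + eval ω y := by
  have h2 : (2 : k) = 0 := CharTwo.two_eq_zero
  obtain ⟨_ | _, _ | _⟩ := x <;> obtain ⟨_ | _, _ | _⟩ := y <;> simp [eval, add] <;> grind

theorem eval_mul (hω : ω ^ 2 + ω + 1 = 0) (x y : GF4) :
    eval ω (mul x y) = eval ω x * eval ω y := by
  have h2 : (2 : k) = 0 := CharTwo.two_eq_zero
  obtain ⟨_ | _, _ | _⟩ := x <;> obtain ⟨_ | _, _ | _⟩ := y <;> simp [eval, mul] <;> grind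

theorem eval_ne_zero [Nontrivial k] (hω : ω ^ 2 + ω + 1 = 0) {x : GF4}
    (hx : x ≠ (false, false)) : eval ω x ≠ 0 := by
  have h2 : (2 : k) = 0 := CharTwo.two_eq_zero
  have h1 : (1 : k) ≠ 0 := one_ne_zero
  obtain ⟨_ | _, _ | _⟩ := x <;> simp [eval] at hx ⊢ <;> grind

end GF4

/-- Polynomials over the field with four elements, as lists of coefficients, constant term
first. -/
abbrev PolyGF4 : Type := List GF4

namespace PolyGF4

/-- Addition of polynomials. -/
def add : PolyGF4 → PolyGF4 → PolyGF4
  | [], q => q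
  | p, [] => p
  | a :: p, b :: q => GF4.add a b :: add p q

/-- Multiplication of polynomials. -/
def mul : PolyGF4 → PolyGF4 → PolyGF4
  | [], _ => []
  | a :: p, q => add (q.map (GF4.mul a)) ((false, false) :: mul p q)

/-- The quotient and the remainder of the division by `X - r`. -/
def divRoot (r : GF4) : PolyGF4 → PolyGF4 × GF4
  | [] => ([], (false, false))
  | c :: p => ((divRoot r p).2 :: (divRoot r p).1, GF4.add c (GF4.mul r (divRoot r p).2))

/-- A test for all coefficients being zero. -/
def isZero (p : PolyGF4) : Bool := p.all (· == (false, false))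

/-- A test for being a nonzero product of a constant and at most `n` factors `X - r` with `r` in
the field with four elements. -/
def splits : ℕ → PolyGF4 → Bool
  | 0, _ => false
  | _, [] => false
  | n + 1, c :: p => (isZero p && c != (false, false)) ||
      [(false, false), (true, false), (false, true), (true, true)].any fun r =>
        (divRoot r (c :: p)).2 == (false, false) && splits n (divRoot r (c :: p)).1

/-- Evaluation at `l`, the coefficients being evaluated at `ω`. -/
def eval {k : Type*} [CommRing k] (ω l : k) : PolyGF4 → k
  | [] => 0
  | c :: p => GF4.eval ω c + l * eval ω l p

variable {k : Type*} [CommRing k] [CharP k 2] {ω l : k}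

theorem eval_add (p q : PolyGF4) : eval ω l (add p q) = eval ω l p + eval ω l q := by
  induction p generalizing q with
  | nil => simp [add, eval]
  | cons a p ih => cases q with
    | nil => simp [add, eval]
    | cons b q => simp only [add, eval, ih, GF4.eval_add]; ring

theorem eval_map_mul (hω : ω ^ 2 + ω + 1 = 0) (a : GF4) (q : PolyGF4) :
    eval ω l (q.map (GF4.mul a)) = GF4.eval ω a * eval ω l q := by
  induction q with
  | nil => simp [eval]
  | cons b q ih => simp only [List.map_cons, eval, ih, GF4.eval_mul hω]; ring

theorem eval_mul (hω : ω ^ 2 + ω + 1 = 0) (p q : PolyGF4) :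
    eval ω l (mul p q) = eval ω l p * eval ω l q := by
  induction p with
  | nil => simp [mul, eval]
  | cons a p ih =>
    simp only [mul, eval_add, eval_map_mul hω, eval, ih]
    simp [GF4.eval]
    ring

theorem eval_divRoot (hω : ω ^ 2 + ω + 1 = 0) (r : GF4) (p : PolyGF4) :
    eval ω l p = (l - GF4.eval ω r) * eval ω l (divRoot r p).1 + GF4.eval ω (divRoot r p).2 := by
  have h2 : (2 : k) = 0 := CharTwo.two_eq_zero
  induction p with
  | nil => simp [divRoot, eval, GF4.eval]
  | cons a p ih =>
    simp only [divRoot, eval, GF4.eval_add, GF4.eval_mul hω]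
    linear_combination l * ih

omit [CharP k 2] in
theorem eval_eq_zero {p : PolyGF4} (hp : isZero p) : eval ω l p = 0 := by
  induction p with
  | nil => rfl
  | cons a p ih =>
    simp only [isZero, List.all_cons, Bool.and_eq_true, beq_iff_eq] at hp ih
    rw [eval, ih hp.2, hp.1]
    simp [GF4.eval]

theorem eval_ne_zero {k : Type*} [Field k] [CharP k 2] {ω l : k} (hω : ω ^ 2 + ω + 1 = 0)
    (hl : ∀ r : GF4, l ≠ GF4.eval ω r) {n : ℕ} {p : PolyGF4} (hp : splits n p) :
    eval ω l p ≠ 0 := by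
  induction n generalizing p with
  | zero => simp [splits] at hp
  | succ n ih =>
    cases p with
    | nil => simp [splits] at hp
    | cons c p =>
      rw [splits, Bool.or_eq_true, List.any_eq_true] at hp
      rcases hp with hp | ⟨r, -, hr⟩
      · simp only [Bool.and_eq_true, bne_iff_ne] at hp
        rw [eval, eval_eq_zero hp.1, mul_zero, add_zero]
        exact GF4.eval_ne_zero hω hp.2
      · simp only [Bool.and_eq_true, beq_iff_eq] at hr
        rw [eval_divRoot hω r, hr.1]
        simpa [GF4.eval, sub_eq_zero] using ⟨hl r, ih hr.2⟩

end PolyGF4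

/-- The coordinates of the points of `Z_B(X)` as polynomials over the field with four elements. -/
def coordZB : Fin 21 → Fin 3 → PolyGF4 :=
  let o := (true, false)
  let w := (false, true)
  let b := (true, true)
  let z := (false, false)
  ![![[o, o], [w, b], [w, b]], ![[o], [w, w], [w]], ![[b, o], [o], [o, o]], ![[o], [w], [w]],
    ![[z, o], [z, b], [b, b]], ![[b, o], [b, b], [z, b]], ![[o], [b], [b]], ![[o, o], [o], [z, o]],
    ![[o], [b], [w]], ![[o], [o, w], []], ![[o], [b], []], ![[o], [o], []],
    ![[z, o], [], [b, o]], ![[o], [], [w]], ![[o], [], [o]], ![[o], [], []],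
    ![[], [z, o], [o]], ![[], [o], [w]], ![[], [o], [o]], ![[], [o], []], ![[], [], [o]]]

/-- The subset of the nine five-point lines formed by those through a point, as a bit mask. -/
def pencilZB : Fin 21 → ℕ :=
  ![1, 2, 4, 7, 8, 16, 25, 32, 42, 64,
    76, 112, 128, 146, 164, 193, 256,
    276, 289, 322, 392]

/-- The collinearity relation of the 21 points. -/
def collinearZB (i j l : Fin 21) : Bool :=
  i == j || j == l || i == l || pencilZB i &&& pencilZB j &&& pencilZB l != 0

/-- The determinant of three of the 21 points. -/
def detZB (i j l : Fin 21) : PolyGF4 :=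
  let m (r s t : Fin 3) : PolyGF4 :=
    (coordZB i r).mul ((coordZB j s).mul (coordZB l t) |>.add ((coordZB j t).mul (coordZB l s)))
  (m 0 1 2).add ((m 1 0 2).add (m 2 0 1))

theorem detZB_spec : ∀ i j l : Fin 21, i < j → j < l →
    if collinearZB i j l then (detZB i j l).isZero else (detZB i j l).splits 4 := by
  decide +kernel

section CombinatoricsZB

open Equiv

/-- The action on the 21 points of the first generator of the stabilizer. -/
def permZB₁ : Perm (Fin 21) where
  toFun := ![2, 0, 1, 3, 12, 7, 14, 9, 15, 5, 13, 11, 16, 18, 19, 17, 4, 8, 10, 6, 20]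
  invFun := ![1, 2, 0, 3, 16, 9, 19, 5, 17, 7, 18, 11, 4, 10, 6, 8, 12, 15, 13, 14, 20]
  left_inv := by decide
  right_inv := by decide

/-- The action on the 21 points of the second generator of the stabilizer. -/
def permZB₂ : Perm (Fin 21) where
  toFun := ![5, 9, 7, 11, 0, 4, 6, 12, 15, 16, 18, 20, 2, 10, 14, 17, 1, 8, 13, 19, 3]
  invFun := ![4, 16, 12, 20, 5, 0, 6, 2, 17, 1, 13, 3, 7, 18, 14, 8, 9, 15, 10, 19, 11]
  left_inv := by decide
  right_inv := by decide

/-- The action on the 21 points of the third generator of the stabilizer. -/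
def permZB₃ : Perm (Fin 21) where
  toFun := ![7, 9, 5, 11, 12, 2, 14, 0, 15, 1, 13, 3, 4, 10, 6, 8, 16, 17, 18, 19, 20]
  invFun := ![7, 9, 5, 11, 12, 2, 14, 0, 15, 1, 13, 3, 4, 10, 6, 8, 16, 17, 18, 19, 20]
  left_inv := by decide
  right_inv := by decide

/-- The actions on the 21 points of the elements of the stabilizer. -/
def permZB (w : Fin 3 × Fin 3 × Fin 2) : Perm (Fin 21) :=
  permZB₁ ^ (w.1 : ℕ) * permZB₂ ^ (w.2.1 : ℕ) * permZB₃ ^ (w.2.2 : ℕ)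

theorem permZB_injective : Function.Injective permZB := by
  intro v w h
  have key : ∀ v w, permZB v 16 = permZB w 16 ∧ permZB v 15 = permZB w 15 → v = w := by
    decide +kernel
  exact key v w (by simp [h])

/-- The number of points that are collinear with two given points. -/
def joinZB (i j : Fin 21) : ℕ := Fintype.card {l // collinearZB i j l}

/-- The number of pairs of points that are collinear with a given point. -/
def valencyZB (i : Fin 21) : ℕ := Fintype.card {p : Fin 21 × Fin 21 // collinearZB i p.1 p.2}

/-- Permutations of the 21 points that preserve collinearity. -/
def IsCollineationZB (σ : Perm (Fin 21)) : Prop :=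
  ∀ i j l, collinearZB (σ i) (σ j) (σ l) = collinearZB i j l

theorem injective_of_collinearZB {σ : Fin 21 → Fin 21}
    (hσ : ∀ i j l, collinearZB (σ i) (σ j) (σ l) = collinearZB i j l) :
    Function.Injective σ := by
  intro i j hij
  have key : ∀ i j, (∀ l, collinearZB i j l) → i = j := by decide +kernel
  refine key i j fun l => ?_
  rw [← hσ, hij]
  simp [collinearZB]

namespace IsCollineationZB

variable {σ : Perm (Fin 21)}

theorem joinZB_eq (hσ : IsCollineationZB σ) (i j : Fin 21) :
    joinZB (σ i) (σ j) = joinZB i j :=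
  (Fintype.card_congr (σ.subtypeEquiv fun l => by rw [hσ i j l])).symm

theorem valencyZB_eq (hσ : IsCollineationZB σ) (i : Fin 21) :
    valencyZB (σ i) = valencyZB i :=
  (Fintype.card_congr ((σ.prodCongr σ).subtypeEquiv fun p => by
    simp only [prodCongr_apply, Prod.map]; rw [hσ i p.1 p.2])).symm

/-- Every image of the point `[0 : l : 1]` is reached by the group of order 9. -/
theorem exists_permZB_apply_eq (hσ : IsCollineationZB σ) :
    ∃ a b, permZB (a, b, 0) 16 = σ 16 := by
  have key : ∀ i, valencyZB i = valencyZB 16 → ∃ a b, permZB (a, b, 0) 16 = i := by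
    decide +kernel
  exact key _ (hσ.valencyZB_eq 16)

theorem mem_line_of_apply_eq (hσ : IsCollineationZB σ) (h16 : σ 16 = 16) {i : Fin 21}
    (hi : 17 ≤ i) : 17 ≤ σ i := by
  have key₁ : ∀ i, 17 ≤ i → joinZB 16 i = 5 := by decide +kernel
  have key₂ : ∀ i, joinZB 16 i = 5 → 17 ≤ i := by decide +kernel
  apply key₂
  simpa [h16, key₁ i hi] using hσ.joinZB_eq 16 i

theorem apply_fifteen (hσ : IsCollineationZB σ) (h17 : σ 17 = 17) (h18 : σ 18 = 18)
    (h19 : σ 19 = 19) (h20 : σ 20 = 20) : σ 15 = 15 ∨ σ 15 = 8 := by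
  have key : ∀ i, joinZB i 17 = joinZB 15 17 → joinZB i 18 = joinZB 15 18 →
      joinZB i 19 = joinZB 15 19 → joinZB i 20 = joinZB 15 20 → i = 15 ∨ i = 8 := by
    decide +kernel
  apply key
  · simpa [h17] using hσ.joinZB_eq 15 17
  · simpa [h18] using hσ.joinZB_eq 15 18
  · simpa [h19] using hσ.joinZB_eq 15 19
  · simpa [h20] using hσ.joinZB_eq 15 20

theorem apply_ten (hσ : IsCollineationZB σ) (h15 : σ 15 = 15) (h17 : σ 17 = 17)
    (h18 : σ 18 = 18) (h19 : σ 19 = 19) : σ 10 = 10 := by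
  have key : ∀ i, collinearZB i 15 19 = collinearZB 10 15 19 →
      joinZB i 17 = joinZB 10 17 → joinZB i 18 = joinZB 10 18 →
      joinZB i 19 = joinZB 10 19 → i = 10 := by
    decide +kernel
  apply key
  · simpa [h15, h19] using hσ 10 15 19
  · simpa [h17] using hσ.joinZB_eq 10 17
  · simpa [h18] using hσ.joinZB_eq 10 18
  · simpa [h19] using hσ.joinZB_eq 10 19

end IsCollineationZB

end CombinatoricsZB

section RealizationZB

open Matrix Equiv

variable {k : Type*} [Field k] [CharP k 2] {ω l : k}

/-- The 21 points of `Z_B(l)`. -/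
def pointZB (ω l : k) (i : Fin 21) : Fin 3 → k := fun r => (coordZB i r).eval ω l

omit [CharP k 2] in
theorem ZBvec_eq_range : ZBvec k ω l = Set.range (pointZB ω l) := by
  have h : pointZB ω l = ![![l + 1, (ω + 1) * l + ω, (ω + 1) * l + ω],
      ![1, ω * l + ω, ω], ![l + ω + 1, 1, l + 1], ![1, ω, ω],
      ![l, (ω + 1) * l, (ω + 1) * l + ω + 1],
      ![l + ω + 1, (ω + 1) * l + ω + 1, (ω + 1) * l],
      ![1, ω + 1, ω + 1], ![l + 1, 1, l], ![1, ω + 1, ω], ![1, ω * l + 1, 0],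
      ![1, ω + 1, 0], ![1, 1, 0], ![l, 0, l + ω + 1], ![1, 0, ω], ![1, 0, 1], ![1, 0, 0],
      ![0, l, 1], ![0, 1, ω], ![0, 1, 1], ![0, 1, 0], ![0, 0, 1]] := by
    ext i r
    fin_cases i <;> fin_cases r <;>
      simp [pointZB, coordZB, PolyGF4.eval, GF4.eval] <;> ring
  simp only [h, ZBvec, Matrix.range_cons, Matrix.range_empty, Set.singleton_union,
    Set.union_empty]

/-- The determinant of three of the 21 points. -/
theorem det_pointZB (hω : ω ^ 2 + ω + 1 = 0) (i j m : Fin 21) :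
    det (of ![pointZB ω l i, pointZB ω l j, pointZB ω l m]) = (detZB i j m).eval ω l := by
  have h2 : (2 : k) = 0 := CharTwo.two_eq_zero
  simp only [det_fin_three, detZB, PolyGF4.eval_add, PolyGF4.eval_mul hω, pointZB, of_apply,
    cons_val]
  grind

theorem det_pointZB_eq_zero_iff (hω : ω ^ 2 + ω + 1 = 0) (hl : ∀ r : GF4, l ≠ GF4.eval ω r)
    (i j m : Fin 21) :
    det (of ![pointZB ω l i, pointZB ω l j, pointZB ω l m]) = 0 ↔ collinearZB i j m := by
  have h2 : (2 : k) = 0 := CharTwo.two_eq_zero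
  have hlt : ∀ i j m, i < j → j < m →
      (det (of ![pointZB ω l i, pointZB ω l j, pointZB ω l m]) = 0 ↔ collinearZB i j m) := by
    intro i j m hij hjm
    rw [det_pointZB hω]
    have := detZB_spec i j m hij hjm
    split_ifs at this with h
    · simp [h, PolyGF4.eval_eq_zero this]
    · simp [h, PolyGF4.eval_ne_zero hω hl this]
  have swap₁ : ∀ u v w : Fin 3 → k, det (of ![u, v, w]) = det (of ![v, u, w]) := by
    intro u v w
    simp only [det_fin_three, of_apply, cons_val]
    grind
  have swap₂ : ∀ u v w : Fin 3 → k, det (of ![u, v, w]) = det (of ![u, w, v]) := by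
    intro u v w
    simp only [det_fin_three, of_apply, cons_val]
    grind
  have swap₁' : ∀ i j m, collinearZB i j m = collinearZB j i m := by decide +kernel
  have swap₂' : ∀ i j m, collinearZB i j m = collinearZB i m j := by decide +kernel
  have hself : ∀ u v : Fin 3 → k, det (of ![u, u, v]) = 0 := fun u v =>
    det_zero_of_row_eq (i := 0) (j := 1) (by decide) rfl
  have hself' : ∀ i j, collinearZB i i j := fun i j => by simp [collinearZB]
  rcases lt_trichotomy i j with hij | rfl | hij
  · rcases lt_trichotomy j m with hjm | rfl | hjm
    · exact hlt i j m hij hjm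
    · rw [swap₁, swap₂, swap₁', swap₂']
      simp [hself, hself']
    · rcases lt_trichotomy i m with him | rfl | him
      · rw [swap₂, swap₂']
        exact hlt i m j him hjm
      · rw [swap₂, swap₂']
        simp [hself, hself']
      · rw [swap₂, swap₂', swap₁, swap₁']
        exact hlt m i j him hij
  · simp [hself, hself']
  · rcases lt_trichotomy i m with him | rfl | him
    · rw [swap₁, swap₁']
      exact hlt j i m hij him
    · rw [swap₂, swap₂']
      simp [hself, hself']
    · rcases lt_trichotomy j m with hjm | rfl | hjm
      · rw [swap₁, swap₁', swap₂, swap₂']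
        exact hlt j m i hjm him
      · rw [swap₁, swap₁', swap₂, swap₂']
        simp [hself, hself']
      · rw [swap₁, swap₁', swap₂, swap₂', swap₁, swap₁']
        exact hlt m j i hjm hij

theorem pointZB_ne_zero (hω : ω ^ 2 + ω + 1 = 0) (hl : ∀ r : GF4, l ≠ GF4.eval ω r)
    (i : Fin 21) : pointZB ω l i ≠ 0 := by
  intro h
  obtain ⟨j, m, hjm⟩ : ∃ j m, ¬ collinearZB i j m := by
    have : ∀ i, ∃ j m, ¬ collinearZB i j m := by decide +kernel
    exact this i
  refine hjm ((det_pointZB_eq_zero_iff hω hl i j m).1 (det_eq_zero_of_row_eq_zero 0 fun r => ?_))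
  simp [h]

/-- The matrix `g` maps each point of `Z_B(l)` to its image under `σ`. -/
def RealizesZB (ω l : k) (g : Matrix (Fin 3) (Fin 3) k) (σ : Fin 21 → Fin 21) : Prop :=
  ∀ i, ∃ c : k, c ≠ 0 ∧ g *ᵥ pointZB ω l i = c • pointZB ω l (σ i)

theorem realizesZB_of_coordZB (hω : ω ^ 2 + ω + 1 = 0) (A : Matrix (Fin 3) (Fin 3) GF4)
    (σ : Fin 21 → Fin 21)
    (h : ∀ i, ∃ c : GF4, c ≠ (false, false) ∧ ∀ r, PolyGF4.isZero
      (PolyGF4.add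
        (PolyGF4.add ((coordZB i 0).map (GF4.mul (A r 0)))
          (PolyGF4.add ((coordZB i 1).map (GF4.mul (A r 1)))
            ((coordZB i 2).map (GF4.mul (A r 2)))))
        ((coordZB (σ i) r).map (GF4.mul c)))) :
    RealizesZB ω l (A.map (GF4.eval ω)) σ := by
  intro i
  obtain ⟨c, hc, h⟩ := h i
  refine ⟨GF4.eval ω c, GF4.eval_ne_zero hω hc, ?_⟩
  ext r
  have := PolyGF4.eval_eq_zero (ω := ω) (l := l) (h r)
  simp only [PolyGF4.eval_add, PolyGF4.eval_map_mul hω, CharTwo.add_eq_zero] at this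
  simp only [mulVec, dotProduct, Fin.sum_univ_three, map_apply, Pi.smul_apply, smul_eq_mul,
    pointZB]
  rw [← this]
  ring

namespace RealizesZB

variable {g h : Matrix (Fin 3) (Fin 3) k} {σ τ : Fin 21 → Fin 21}

theorem collinearZB_eq (hω : ω ^ 2 + ω + 1 = 0) (hl : ∀ r : GF4, l ≠ GF4.eval ω r)
    (hg : RealizesZB ω l g σ) (hdet : g.det ≠ 0) (i j m : Fin 21) :
    collinearZB (σ i) (σ j) (σ m) = collinearZB i j m := by
  obtain ⟨a, ha, hi⟩ := hg i
  obtain ⟨b, hb, hj⟩ := hg j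
  obtain ⟨c, hc, hm⟩ := hg m
  have h₁ : of ![g *ᵥ pointZB ω l i, g *ᵥ pointZB ω l j, g *ᵥ pointZB ω l m] =
      of ![pointZB ω l i, pointZB ω l j, pointZB ω l m] * gᵀ := by
    ext r s
    fin_cases r <;> simp [mulVec, dotProduct, mul_apply, Fin.sum_univ_three, mul_comm]
  have h₂ : of ![g *ᵥ pointZB ω l i, g *ᵥ pointZB ω l j, g *ᵥ pointZB ω l m] =
      diagonal ![a, b, c] *
        of ![pointZB ω l (σ i), pointZB ω l (σ j), pointZB ω l (σ m)] := by
    ext r s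
    fin_cases r <;> simp [hi, hj, hm, diagonal_mul]
  have h₃ := congrArg det (h₁.symm.trans h₂)
  rw [det_mul, det_mul, det_transpose, det_diagonal, Fin.prod_univ_three] at h₃
  rw [Bool.eq_iff_iff, ← det_pointZB_eq_zero_iff hω hl, ← det_pointZB_eq_zero_iff hω hl]
  constructor
  · intro h
    rw [h, mul_zero] at h₃
    exact (mul_eq_zero.1 h₃).resolve_right hdet
  · intro h
    rw [h, zero_mul] at h₃
    exact (mul_eq_zero.1 h₃.symm).resolve_left (by simp [ha, hb, hc])

omit [CharP k 2] in
theorem mul (hg : RealizesZB ω l g σ) (hh : RealizesZB ω l h τ) :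
    RealizesZB ω l (g * h) (σ ∘ τ) := by
  intro i
  obtain ⟨a, ha, hi⟩ := hh i
  obtain ⟨b, hb, hj⟩ := hg (τ i)
  exact ⟨a * b, mul_ne_zero ha hb, by rw [← mulVec_mulVec, hi, mulVec_smul, hj, smul_smul]; rfl⟩

omit [CharP k 2] in
theorem scalar {c : k} (hc : c ≠ 0) : RealizesZB ω l (Matrix.scalar (Fin 3) c) id := fun i =>
  ⟨c, hc, by simp⟩

omit [CharP k 2] in
theorem of_mul_eq_one {σ : Perm (Fin 21)} (hg : RealizesZB ω l g σ) (hgh : h * g = 1) :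
    RealizesZB ω l h σ.symm := by
  intro i
  obtain ⟨a, ha, hi⟩ := hg (σ.symm i)
  refine ⟨a⁻¹, inv_ne_zero ha, ?_⟩
  rw [apply_symm_apply] at hi
  have := congrArg (a⁻¹ • h *ᵥ ·) hi
  simpa [mulVec_smul, smul_smul, ha, hgh] using this.symm

theorem unique (hω : ω ^ 2 + ω + 1 = 0) (hl : ∀ r : GF4, l ≠ GF4.eval ω r)
    (hσ : RealizesZB ω l g σ) (hτ : RealizesZB ω l g τ) : σ = τ := by
  ext1 i
  obtain ⟨a, ha, hi⟩ := hσ i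
  obtain ⟨b, hb, hj⟩ := hτ i
  have key : ∀ i j, (∀ l, collinearZB i j l) → i = j := by decide +kernel
  refine key _ _ fun m => (det_pointZB_eq_zero_iff hω hl _ _ m).1 ?_
  have h : pointZB ω l (σ i) = (a⁻¹ * b) • pointZB ω l (τ i) := by
    rw [mul_smul, ← hj, hi, smul_smul, inv_mul_cancel₀ ha, one_smul]
  simp only [h, det_fin_three, of_apply, cons_val, Pi.smul_apply, smul_eq_mul]
  ring

/-- A matrix that fixes `[0 : l : 1]` fixes the line `x = 0` pointwise. -/
theorem fixes_line (hω : ω ^ 2 + ω + 1 = 0) (hl : ∀ r : GF4, l ≠ GF4.eval ω r)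
    (hg : RealizesZB ω l g σ) (hσ : Function.Injective σ) (h16 : σ 16 = 16)
    (hline : ∀ i, 17 ≤ i → 17 ≤ σ i) :
    σ 17 = 17 ∧ σ 18 = 18 ∧ σ 19 = 19 ∧ σ 20 = 20 := by
  have h2 : (2 : k) = 0 := CharTwo.two_eq_zero
  have hl₀ := hl (false, false)
  have hl₁ := hl (true, false)
  have hl₂ := hl (false, true)
  have hl₃ := hl (true, true)
  obtain ⟨a, ha, ha'⟩ := hg 16
  obtain ⟨b, hb, hb'⟩ := hg 17
  obtain ⟨c, hc, hc'⟩ := hg 18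
  obtain ⟨d, hd, hd'⟩ := hg 19
  obtain ⟨e, he, he'⟩ := hg 20
  have cases_line : ∀ i : Fin 21, 17 ≤ i → i = 17 ∨ i = 18 ∨ i = 19 ∨ i = 20 := by decide
  have n₁ : σ 17 ≠ σ 18 := hσ.ne (by decide)
  have n₂ : σ 17 ≠ σ 19 := hσ.ne (by decide)
  have n₃ : σ 17 ≠ σ 20 := hσ.ne (by decide)
  have n₄ : σ 18 ≠ σ 19 := hσ.ne (by decide)
  have n₅ : σ 18 ≠ σ 20 := hσ.ne (by decide)
  have n₆ : σ 19 ≠ σ 20 := hσ.ne (by decide)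
  have e16 : pointZB ω l 16 = ![0, l, 1] := by
    ext r; fin_cases r <;> simp [pointZB, coordZB, PolyGF4.eval, GF4.eval]
  have e17 : pointZB ω l 17 = ![0, 1, ω] := by
    ext r; fin_cases r <;> simp [pointZB, coordZB, PolyGF4.eval, GF4.eval]
  have e18 : pointZB ω l 18 = ![0, 1, 1] := by
    ext r; fin_cases r <;> simp [pointZB, coordZB, PolyGF4.eval, GF4.eval]
  have e19 : pointZB ω l 19 = ![0, 1, 0] := by
    ext r; fin_cases r <;> simp [pointZB, coordZB, PolyGF4.eval, GF4.eval]
  have e20 : pointZB ω l 20 = ![0, 0, 1] := by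
    ext r; fin_cases r <;> simp [pointZB, coordZB, PolyGF4.eval, GF4.eval]
  have r16 := congrArg (fun v => (v 1, v 2)) ha'
  have r17 := congrArg (fun v => (v 1, v 2)) hb'
  have r18 := congrArg (fun v => (v 1, v 2)) hc'
  have r19 := congrArg (fun v => (v 1, v 2)) hd'
  have r20 := congrArg (fun v => (v 1, v 2)) he'
  rw [h16] at r16
  simp only [GF4.eval] at hl₀ hl₁ hl₂ hl₃
  rcases cases_line (σ 19) (hline 19 (by decide)) with h19 | h19 | h19 | h19 <;>
  rcases cases_line (σ 20) (hline 20 (by decide)) with h20 | h20 | h20 | h20 <;>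
  rcases cases_line (σ 18) (hline 18 (by decide)) with h18 | h18 | h18 | h18 <;>
  rcases cases_line (σ 17) (hline 17 (by decide)) with h17 | h17 | h17 | h17 <;>
  first
  | exact absurd (h19.trans h20.symm) n₆
  | exact absurd (h18.trans h20.symm) n₅
  | exact absurd (h18.trans h19.symm) n₄
  | exact absurd (h17.trans h20.symm) n₃
  | exact absurd (h17.trans h19.symm) n₂
  | exact absurd (h17.trans h18.symm) n₁
  | exact ⟨h17, h18, h19, h20⟩
  | skip
  all_goals
    exfalso
    simp [h17, h18, h19, h20, e16, e17, e18, e19, e20, mulVec, dotProduct,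
      Fin.sum_univ_three] at r16 r17 r18 r19 r20 hl₀ hl₁ hl₂ hl₃
    clear ha' hb' hc' hd' he' e16 e17 e18 e19 e20 n₁ n₂ n₃ n₄ n₅ n₆ hline cases_line hσ hg hl
    grind

/-- A matrix that fixes enough of the points is scalar. -/
theorem eq_scalar (hω : ω ^ 2 + ω + 1 = 0) (hg : RealizesZB ω l g σ) (h10 : σ 10 = 10)
    (h15 : σ 15 = 15) (h18 : σ 18 = 18) (h19 : σ 19 = 19) (h20 : σ 20 = 20) :
    ∃ c, c ≠ 0 ∧ g = Matrix.scalar (Fin 3) c := by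
  have h2 : (2 : k) = 0 := CharTwo.two_eq_zero
  obtain ⟨a, ha, ha'⟩ := hg 10
  obtain ⟨b, hb, hb'⟩ := hg 15
  obtain ⟨c, hc, hc'⟩ := hg 18
  obtain ⟨d, hd, hd'⟩ := hg 19
  obtain ⟨e, he, he'⟩ := hg 20
  refine ⟨b, hb, ?_⟩
  rw [funext_iff, Fin.forall_fin_succ, Fin.forall_fin_succ, Fin.forall_fin_one] at ha' hb' hc' hd' he'
  simp [h10, h15, h18, h19, h20, pointZB, coordZB, PolyGF4.eval, GF4.eval, mulVec, dotProduct,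
    Fin.sum_univ_three] at ha' hb' hc' hd' he'
  ext r s
  fin_cases r <;> fin_cases s <;> simp <;> grind

end RealizesZB

end RealizationZB

section StabilizerZB

open Matrix Equiv

variable {k : Type*} [Field k]

theorem actGL_mk (g : GL (Fin 3) k) {v : Fin 3 → k} (hv : v ≠ 0)
    (hgv : (g : Matrix (Fin 3) (Fin 3) k) *ᵥ v ≠ 0) :
    actGL k g (Projectivization.mk k v hv) = Projectivization.mk k _ hgv := by
  obtain ⟨a, ha⟩ := (Projectivization.mk_eq_mk_iff' k _ _
    (Projectivization.mk k v hv).rep_nonzero hv).1 (Projectivization.mk_rep _)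
  rw [actGL, Projectivization.mk_eq_mk_iff']
  exact ⟨a, by rw [← mulVec_smul, ha]⟩

variable [CharP k 2] {ω l : k}

theorem mem_ZBpts_iff (hω : ω ^ 2 + ω + 1 = 0) (hl : ∀ r : GF4, l ≠ GF4.eval ω r)
    {P : Projectivization k (Fin 3 → k)} :
    P ∈ ZBpts k ω l ↔
      ∃ i, P = Projectivization.mk k (pointZB ω l i) (pointZB_ne_zero hω hl i) := by
  rw [ZBpts, ZBvec_eq_range]
  simp [pointZB_ne_zero hω hl]

/-- A matrix preserves `Z_B(l)` exactly when it permutes the 21 points up to scalars. -/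
theorem image_actGL_ZBpts_iff (hω : ω ^ 2 + ω + 1 = 0) (hl : ∀ r : GF4, l ≠ GF4.eval ω r)
    (g : GL (Fin 3) k) :
    actGL k g '' ZBpts k ω l = ZBpts k ω l ↔ ∃ σ : Perm (Fin 21), RealizesZB ω l g.val σ := by
  have hdet : g.val.det ≠ 0 := ((Matrix.isUnit_iff_isUnit_det _).1 g.isUnit).ne_zero
  have hne : ∀ i, g.val *ᵥ pointZB ω l i ≠ 0 := fun i h =>
    hdet (exists_mulVec_eq_zero_iff.1 ⟨_, pointZB_ne_zero hω hl i, h⟩)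
  constructor
  · intro h
    have hσ : ∀ i, ∃ j, ∃ c : k, c ≠ 0 ∧ g.val *ᵥ pointZB ω l i = c • pointZB ω l j := by
      intro i
      have hi := h ▸ Set.mem_image_of_mem (actGL k g) ((mem_ZBpts_iff hω hl).2 ⟨i, rfl⟩)
      obtain ⟨j, hj⟩ := (mem_ZBpts_iff hω hl).1 hi
      rw [actGL_mk g _ (hne i), Projectivization.mk_eq_mk_iff'] at hj
      obtain ⟨c, hc⟩ := hj
      refine ⟨j, c, ?_, hc.symm⟩
      rintro rfl
      exact hne i (by rw [← hc, zero_smul])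
    choose σ hσ using hσ
    have hg : RealizesZB ω l g.val σ := hσ
    have hinj := injective_of_collinearZB (hg.collinearZB_eq hω hl hdet)
    exact ⟨Equiv.ofBijective σ (Finite.injective_iff_bijective.1 hinj), hg⟩
  · rintro ⟨σ, hσ⟩
    have key : ∀ i, actGL k g (Projectivization.mk k _ (pointZB_ne_zero hω hl i)) =
        Projectivization.mk k _ (pointZB_ne_zero hω hl (σ i)) := by
      intro i
      obtain ⟨c, -, hc⟩ := hσ i
      rw [actGL_mk g _ (hne i), Projectivization.mk_eq_mk_iff']
      exact ⟨c, hc.symm⟩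
    ext P
    constructor
    · rintro ⟨Q, hQ, rfl⟩
      obtain ⟨i, rfl⟩ := (mem_ZBpts_iff hω hl).1 hQ
      exact (mem_ZBpts_iff hω hl).2 ⟨σ i, key i⟩
    · intro hP
      obtain ⟨i, rfl⟩ := (mem_ZBpts_iff hω hl).1 hP
      refine ⟨_, (mem_ZBpts_iff hω hl).2 ⟨σ.symm i, rfl⟩, ?_⟩
      rw [key]
      simp

/-- The stabilizer of `Z_B(l)` as a subgroup. -/
def stabilizerZB (ω l : k) : Subgroup (PGL3 k) where
  carrier := {x | ∃ (g : GL (Fin 3) k) (σ : Perm (Fin 21)),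
    QuotientGroup.mk g = x ∧ RealizesZB ω l g.val σ}
  mul_mem' := by
    rintro _ _ ⟨g, σ, rfl, hg⟩ ⟨h, τ, rfl, hh⟩
    exact ⟨g * h, σ * τ, rfl, hg.mul hh⟩
  one_mem' := ⟨1, 1, rfl, by simpa using RealizesZB.scalar (ω := ω) (l := l) one_ne_zero⟩
  inv_mem' := by
    rintro _ ⟨g, σ, rfl, hg⟩
    exact ⟨g⁻¹, σ⁻¹, rfl, hg.of_mul_eq_one (by simp)⟩

omit [CharP k 2] in
theorem RealizesZB.of_mk_eq {g h : GL (Fin 3) k} {σ : Fin 21 → Fin 21}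
    (hg : RealizesZB ω l g.val σ) (hgh : (QuotientGroup.mk g : PGL3 k) = QuotientGroup.mk h) :
    RealizesZB ω l h.val σ := by
  obtain ⟨c, hc⟩ := GeneralLinearGroup.mem_center_iff_val_mem_range_scalar.1 (QuotientGroup.eq.1 hgh)
  have hc0 : c ≠ 0 := by
    rintro rfl
    have := (g⁻¹ * h).ne_zero
    rw [← hc] at this
    simp at this
  have := hg.mul (RealizesZB.scalar (ω := ω) (l := l) hc0)
  rwa [hc, ← Units.val_mul, mul_inv_cancel_left] at this

theorem PGLstab_eq_stabilizerZB (hω : ω ^ 2 + ω + 1 = 0) (hl : ∀ r : GF4, l ≠ GF4.eval ω r) :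
    PGLstab k (ZBpts k ω l) = stabilizerZB ω l := by
  ext x
  constructor
  · intro hx
    obtain ⟨g, rfl⟩ := QuotientGroup.mk_surjective x
    obtain ⟨σ, hσ⟩ := (image_actGL_ZBpts_iff hω hl g).1 (hx g rfl)
    exact ⟨g, σ, rfl, hσ⟩
  · rintro ⟨g, σ, rfl, hg⟩ h hh
    exact (image_actGL_ZBpts_iff hω hl h).2 ⟨σ, hg.of_mk_eq hh.symm⟩

theorem realizesZB_permZB₁ (hω : ω ^ 2 + ω + 1 = 0) :
    RealizesZB ω l !![0, ω, 0; ω + 1, 1, 0; 1, 1, 1] permZB₁ := by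
  convert realizesZB_of_coordZB hω
    !![(false, false), (false, true), (false, false);
       (true, true), (true, false), (false, false);
       (true, false), (true, false), (true, false)] permZB₁ (by decide +kernel) using 1
  ext r s
  fin_cases r <;> fin_cases s <;> simp [GF4.eval, add_comm]

theorem realizesZB_permZB₂ (hω : ω ^ 2 + ω + 1 = 0) :
    RealizesZB ω l !![0, 0, ω + 1; 1, 1, 1; ω, 0, 1] permZB₂ := by
  convert realizesZB_of_coordZB hω
    !![(false, false), (false, false), (true, true);
       (true, false), (true, false), (true, false);
       (false, true), (false, false), (true, false)] permZB₂ (by decide +kernel) using 1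
  ext r s
  fin_cases r <;> fin_cases s <;> simp [GF4.eval, add_comm]

theorem realizesZB_permZB₃ (hω : ω ^ 2 + ω + 1 = 0) :
    RealizesZB ω l !![1, 0, 0; ω + 1, 1, 0; ω, 0, 1] permZB₃ := by
  convert realizesZB_of_coordZB hω
    !![(true, false), (false, false), (false, false);
       (true, true), (true, false), (false, false);
       (false, true), (false, false), (true, false)] permZB₃ (by decide +kernel) using 1
  ext r s
  fin_cases r <;> fin_cases s <;> simp [GF4.eval, add_comm]

/-- The generators are invertible. -/
theorem exists_generators_ZB (hω : ω ^ 2 + ω + 1 = 0) : ∃ g₁ g₂ g₃ : GL (Fin 3) k,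
    g₁.val = !![0, ω, 0; ω + 1, 1, 0; 1, 1, 1] ∧ g₂.val = !![0, 0, ω + 1; 1, 1, 1; ω, 0, 1] ∧
      g₃.val = !![1, 0, 0; ω + 1, 1, 0; ω, 0, 1] := by
  have h2 : (2 : k) = 0 := CharTwo.two_eq_zero
  have h1 : (1 : k) ≠ 0 := one_ne_zero
  refine ⟨GeneralLinearGroup.mkOfDetNeZero _ ?_, GeneralLinearGroup.mkOfDetNeZero _ ?_,
    GeneralLinearGroup.mkOfDetNeZero _ ?_, rfl, rfl, rfl⟩ <;>
  · simp only [det_fin_three, of_apply, cons_val]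
    grind

/-- Modulo scalars, the products of powers of the generators exhaust the stabilizer. -/
theorem RealizesZB.exists_permZB (hω : ω ^ 2 + ω + 1 = 0) (hl : ∀ r : GF4, l ≠ GF4.eval ω r)
    {W : Fin 3 × Fin 3 × Fin 2 → GL (Fin 3) k} (hW : ∀ w, RealizesZB ω l (W w).val (permZB w))
    {g : GL (Fin 3) k} {σ : Perm (Fin 21)} (hg : RealizesZB ω l g.val σ) :
    ∃ w, (QuotientGroup.mk (W w) : PGL3 k) = QuotientGroup.mk g := by
  have hcoll : ∀ {g : GL (Fin 3) k} {σ : Perm (Fin 21)}, RealizesZB ω l g.val σ →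
      IsCollineationZB σ := fun {g _} hg =>
    hg.collinearZB_eq hω hl ((Matrix.isUnit_iff_isUnit_det _).1 g.isUnit).ne_zero
  have hdiv : ∀ w, RealizesZB ω l ((W w)⁻¹ * g).val ((permZB w)⁻¹ * σ : Perm (Fin 21)) :=
    fun w => ((hW w).of_mul_eq_one (by simp)).mul hg
  obtain ⟨a, b, hab⟩ := (hcoll hg).exists_permZB_apply_eq
  have h₁ := hdiv (a, b, 0)
  have h16 : ((permZB (a, b, 0))⁻¹ * σ) 16 = 16 := by
    rw [Perm.mul_apply, ← hab, Perm.inv_eq_iff_eq]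
  obtain ⟨h17, h18, h19, h20⟩ := h₁.fixes_line hω hl (Equiv.injective _) h16
    fun i hi => (hcoll h₁).mem_line_of_apply_eq h16 hi
  obtain ⟨c, h15, h17, h18, h19, h20⟩ : ∃ c, ((permZB (a, b, c))⁻¹ * σ) 15 = 15 ∧
      ((permZB (a, b, c))⁻¹ * σ) 17 = 17 ∧ ((permZB (a, b, c))⁻¹ * σ) 18 = 18 ∧
      ((permZB (a, b, c))⁻¹ * σ) 19 = 19 ∧ ((permZB (a, b, c))⁻¹ * σ) 20 = 20 := by
    rcases (hcoll h₁).apply_fifteen h17 h18 h19 h20 with h15 | h15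
    · exact ⟨0, h15, h17, h18, h19, h20⟩
    · have h : ∀ i, ((permZB (a, b, 1))⁻¹ * σ) i =
          permZB₃⁻¹ (((permZB (a, b, 0))⁻¹ * σ) i) := by simp [permZB]
      refine ⟨1, ?_⟩
      simp only [h, h15, h17, h18, h19, h20]
      decide
  refine ⟨(a, b, c), QuotientGroup.eq.2 ?_⟩
  have h₂ := hdiv (a, b, c)
  obtain ⟨d, -, hd⟩ := h₂.eq_scalar hω ((hcoll h₂).apply_ten h15 h17 h18 h19) h15 h18 h19 h20
  exact GeneralLinearGroup.mem_center_iff_val_mem_range_scalar.2 ⟨d, hd.symm⟩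

end StabilizerZB

/-- for `α ∉ {0,1,ω,ω̄}`, the stabilizer in `PGL(3,k)` of the 21-point set
`Z_B(α)` is the subgroup of `PGL(3,k)` generated by the images of the three listed matrices;
in particular it has order 18. -/
theorem stabilizer_ZB (k : Type*) [Field k] [IsAlgClosed k] [CharP k 2]
    (ω : k) (hω : ω ^ 2 + ω + 1 = 0) (α : k)
    (h0 : α ≠ 0) (h1 : α ≠ 1) (h2 : α ≠ ω) (h3 : α ≠ ω + 1) :
    PGLstab k (ZBpts k ω α) =
      ↑(Subgroup.closure
        {x : PGL3 k | ∃ g : Matrix.GeneralLinearGroup (Fin 3) k,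
          ((g : Matrix (Fin 3) (Fin 3) k) = !![0, ω, 0; ω + 1, 1, 0; 1, 1, 1] ∨
           (g : Matrix (Fin 3) (Fin 3) k) = !![0, 0, ω + 1; 1, 1, 1; ω, 0, 1] ∨
           (g : Matrix (Fin 3) (Fin 3) k) = !![1, 0, 0; ω + 1, 1, 0; ω, 0, 1]) ∧
          QuotientGroup.mk g = x}) ∧
    Nat.card (PGLstab k (ZBpts k ω α)) = 18 := by
  have hl : ∀ r : GF4, α ≠ GF4.eval ω r := by
    rintro ⟨_ | _, _ | _⟩ <;> simpa [GF4.eval, add_comm]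
  obtain ⟨g₁, g₂, g₃, hg₁, hg₂, hg₃⟩ := exists_generators_ZB hω
  have hr₁ : RealizesZB ω α g₁.val permZB₁ := hg₁ ▸ realizesZB_permZB₁ hω
  have hr₂ : RealizesZB ω α g₂.val permZB₂ := hg₂ ▸ realizesZB_permZB₂ hω
  have hr₃ : RealizesZB ω α g₃.val permZB₃ := hg₃ ▸ realizesZB_permZB₃ hω
  have hpow : ∀ {g : Matrix.GeneralLinearGroup (Fin 3) k} {σ : Equiv.Perm (Fin 21)},
      RealizesZB ω α g.val σ → ∀ n : ℕ, RealizesZB ω α (g ^ n).val (σ ^ n : Equiv.Perm _) := by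
    intro g σ h n
    induction n with
    | zero => simpa using RealizesZB.scalar (ω := ω) (l := α) one_ne_zero
    | succ n ih => rw [pow_succ, pow_succ]; exact ih.mul h
  let W : Fin 3 × Fin 3 × Fin 2 → Matrix.GeneralLinearGroup (Fin 3) k := fun w =>
    g₁ ^ (w.1 : ℕ) * g₂ ^ (w.2.1 : ℕ) * g₃ ^ (w.2.2 : ℕ)
  have hW : ∀ w, RealizesZB ω α (W w).val (permZB w) := fun w =>
    ((hpow hr₁ _).mul (hpow hr₂ _)).mul (hpow hr₃ _)
  rw [PGLstab_eq_stabilizerZB hω hl]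
  constructor
  · rw [SetLike.coe_set_eq]
    apply le_antisymm
    · rintro _ ⟨g, σ, rfl, hg⟩
      obtain ⟨w, hw⟩ := hg.exists_permZB hω hl hW
      rw [← hw]
      refine Subgroup.mul_mem _ (Subgroup.mul_mem _
        (Subgroup.pow_mem _ (Subgroup.subset_closure (?_ : QuotientGroup.mk g₁ ∈ _)) _)
        (Subgroup.pow_mem _ (Subgroup.subset_closure (?_ : QuotientGroup.mk g₂ ∈ _)) _))
        (Subgroup.pow_mem _ (Subgroup.subset_closure (?_ : QuotientGroup.mk g₃ ∈ _)) _)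
      exacts [⟨g₁, .inl hg₁, rfl⟩, ⟨g₂, .inr (.inl hg₂), rfl⟩, ⟨g₃, .inr (.inr hg₃), rfl⟩]
    · rw [Subgroup.closure_le]
      rintro _ ⟨g, hg | hg | hg, rfl⟩
      exacts [⟨g, permZB₁, rfl, hg ▸ realizesZB_permZB₁ hω⟩,
        ⟨g, permZB₂, rfl, hg ▸ realizesZB_permZB₂ hω⟩,
        ⟨g, permZB₃, rfl, hg ▸ realizesZB_permZB₃ hω⟩]
  · let f : Fin 3 × Fin 3 × Fin 2 → stabilizerZB ω α := fun w =>
      ⟨QuotientGroup.mk (W w), W w, permZB w, rfl, hW w⟩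
    have hf : Function.Bijective f := by
      constructor
      · intro v w hvw
        apply permZB_injective
        apply DFunLike.coe_injective
        exact ((hW v).of_mk_eq (congrArg Subtype.val hvw)).unique hω hl (hW w)
      · rintro ⟨_, g, σ, rfl, hg⟩
        obtain ⟨w, hw⟩ := hg.exists_permZB hω hl hW
        exact ⟨w, Subtype.ext hw⟩
    calc Nat.card (stabilizerZB ω α) = Nat.card (Fin 3 × Fin 3 × Fin 2) :=
          (Nat.card_eq_of_bijective f hf).symm
      _ = 18 := by simp
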